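/- Let α ∈ (0,1], T > 0, and let f : [0,T] × ℝ → ℝ be continuous and satisfy the Lipschitz condition. Let x₁, x₂ be solutions on [0,T] of the Caputo fractional initial value problems with initial values x₁₀ < x₂₀. Then for all t ∈ [0,T]: (x₂(0) − x₁(0))·E_α(ã_*(t) t^α) ≤ x₂(t) − x₁(t) ≤ (x₂(0) − x₁(0))·E_α(ã^*(t) t^α), where ã_*(t) := inf_{s ∈ [0,t], x ≠ 0} (f(s, x + x₁(s)) − f(s, x₁(s)))/x and ã^*(t) := sup_{s ∈ [0,t], x ≠ 0} (f(s, x + x₁(s)) − f(s, x₁(s)))/x. -/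

import Mathlib

open Set intervalIntegral

/-- The one-parameter Mittag-Leffler function `E_α(x) = ∑_{k=0}^∞ x^k / Γ(αk+1)`. -/
noncomputable def mittagLeffler (α x : ℝ) : ℝ :=
  ∑' k : ℕ, x ^ k / Real.Gamma (α * (k : ℝ) + 1)

/-- A continuous function `x` on `[0,T]` solves the Caputo fractional initial value
problem `^C D^α_{0+} x(t) = f(t,x(t))`, `x(0) = x₀`, in the equivalent Volterra
integral formulation. -/
def IsCaputoSolution (α T : ℝ) (f : ℝ → ℝ → ℝ) (x₀ : ℝ) (x : ℝ → ℝ) : Prop :=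
  ContinuousOn x (Set.Icc 0 T) ∧
    ∀ t ∈ Set.Icc 0 T,
      x t = x₀ + (1 / Real.Gamma α) * ∫ s in (0:ℝ)..t, (t - s) ^ (α - 1) * f s (x s)

open MeasureTheory Filter Topology

/-- The Riemann–Liouville fractional integral of order `α` based at `0`. -/
noncomputable def fracIntegral (α : ℝ) (h : ℝ → ℝ) (s : ℝ) : ℝ :=
  (1 / Real.Gamma α) * ∫ τ in (0:ℝ)..s, (s - τ) ^ (α - 1) * h τ

theorem integral_rpow_mul_sub_rpow {p q s : ℝ} (hp : 0 < p) (hq : 0 < q) (hs : 0 < s) :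
    ∫ τ in (0:ℝ)..s, (s - τ) ^ (q - 1) * τ ^ (p - 1) =
      s ^ (p + q - 1) * (Real.Gamma p * Real.Gamma q / Real.Gamma (p + q)) := by
  have h := Complex.betaIntegral_scaled p q hs
  have hb : Complex.betaIntegral p q =
      ((Real.Gamma p * Real.Gamma q / Real.Gamma (p + q) : ℝ) : ℂ) := by
    rw [Complex.betaIntegral_eq_Gamma_mul_div]
    · rw [← Complex.ofReal_add, Complex.Gamma_ofReal, Complex.Gamma_ofReal, Complex.Gamma_ofReal]
      norm_cast
    · simpa using hp
    · simpa using hq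
  rw [hb] at h
  have h2 : ∫ x in (0:ℝ)..s, (x : ℂ) ^ ((p : ℂ) - 1) * ((s : ℂ) - x) ^ ((q : ℂ) - 1) =
      ((∫ τ in (0:ℝ)..s, (s - τ) ^ (q - 1) * τ ^ (p - 1) : ℝ) : ℂ) := by
    rw [← intervalIntegral.integral_ofReal]
    refine intervalIntegral.integral_congr fun τ hτ => ?_
    rw [Set.uIcc_of_le hs.le] at hτ
    have h1 : ((p : ℂ) - 1) = ((p - 1 : ℝ) : ℂ) := by push_cast; rfl
    have h2 : ((q : ℂ) - 1) = ((q - 1 : ℝ) : ℂ) := by push_cast; rfl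
    rw [h1, h2, ← Complex.ofReal_sub, ← Complex.ofReal_cpow hτ.1,
      ← Complex.ofReal_cpow (sub_nonneg.2 hτ.2), ← Complex.ofReal_mul, mul_comm]
  rw [h2] at h
  have h3 : ((p : ℂ) + q - 1) = ((p + q - 1 : ℝ) : ℂ) := by push_cast; rfl
  rw [h3, ← Complex.ofReal_cpow hs.le, ← Complex.ofReal_mul] at h
  exact_mod_cast h

theorem intervalIntegrable_sub_rpow {β : ℝ} (hβ : -1 < β) (a b s : ℝ) :
    IntervalIntegrable (fun τ : ℝ => (s - τ) ^ β) volume a b := by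
  have := (intervalIntegral.intervalIntegrable_rpow' (a := s - a) (b := s - b) hβ).comp_sub_left s
  simpa using this

theorem intervalIntegrable_sub_rpow_mul {β a b : ℝ} (hβ : -1 < β) (s : ℝ) (hab : a ≤ b)
    {h : ℝ → ℝ} (hh : ContinuousOn h (Icc a b)) :
    IntervalIntegrable (fun τ : ℝ => (s - τ) ^ β * h τ) volume a b :=
  (intervalIntegrable_sub_rpow hβ a b s).mul_continuousOn (by rwa [Set.uIcc_of_le hab])

theorem integral_sub_rpow {β s : ℝ} (hβ : -1 < β) :
    ∫ τ in (0:ℝ)..s, (s - τ) ^ β = s ^ (β + 1) / (β + 1) := by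
  rw [intervalIntegral.integral_comp_sub_left (fun x => x ^ β), integral_rpow (Or.inl hβ)]
  simp [Real.zero_rpow (by linarith : β + 1 ≠ 0)]

section FracIntegral

variable {α : ℝ}

theorem fracIntegral_zero_right (h : ℝ → ℝ) : fracIntegral α h 0 = 0 := by
  simp [fracIntegral]

theorem fracIntegral_congr {g h : ℝ → ℝ} {s : ℝ} (hs : 0 ≤ s)
    (hgh : ∀ τ ∈ Icc 0 s, g τ = h τ) : fracIntegral α g s = fracIntegral α h s := by
  unfold fracIntegral
  congr 1
  refine intervalIntegral.integral_congr fun τ hτ => ?_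
  rw [Set.uIcc_of_le hs] at hτ
  simp only [hgh τ hτ]

theorem fracIntegral_add (hα : 0 < α) {g h : ℝ → ℝ} {s : ℝ} (hs : 0 ≤ s)
    (hg : ContinuousOn g (Icc 0 s)) (hh : ContinuousOn h (Icc 0 s)) :
    fracIntegral α (fun τ => g τ + h τ) s = fracIntegral α g s + fracIntegral α h s := by
  unfold fracIntegral
  simp only [mul_add]
  rw [intervalIntegral.integral_add (intervalIntegrable_sub_rpow_mul (by linarith) s hs hg)
    (intervalIntegrable_sub_rpow_mul (by linarith) s hs hh), mul_add]

theorem fracIntegral_const_mul (c : ℝ) (h : ℝ → ℝ) (s : ℝ) :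
    fracIntegral α (fun τ => c * h τ) s = c * fracIntegral α h s := by
  unfold fracIntegral
  rw [mul_left_comm, ← intervalIntegral.integral_const_mul c]
  simp only [mul_left_comm]

theorem fracIntegral_sub (hα : 0 < α) {g h : ℝ → ℝ} {s : ℝ} (hs : 0 ≤ s)
    (hg : ContinuousOn g (Icc 0 s)) (hh : ContinuousOn h (Icc 0 s)) :
    fracIntegral α (fun τ => g τ - h τ) s = fracIntegral α g s - fracIntegral α h s := by
  unfold fracIntegral
  simp only [mul_sub]
  rw [intervalIntegral.integral_sub (intervalIntegrable_sub_rpow_mul (by linarith) s hs hg)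
    (intervalIntegrable_sub_rpow_mul (by linarith) s hs hh), mul_sub]

theorem fracIntegral_rpow (hα : 0 < α) {r s : ℝ} (hr : 0 ≤ r) (hs : 0 ≤ s) :
    fracIntegral α (fun τ => τ ^ r) s =
      Real.Gamma (r + 1) / Real.Gamma (r + α + 1) * s ^ (r + α) := by
  rcases hs.eq_or_lt with rfl | hs
  · rw [fracIntegral_zero_right, Real.zero_rpow (by linarith), mul_zero]
  · have h := integral_rpow_mul_sub_rpow (p := r + 1) (q := α) (by linarith) hα hs
    simp only [add_sub_cancel_right] at h
    unfold fracIntegral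
    have := (Real.Gamma_pos_of_pos hα).ne'
    rw [h, show r + 1 + α - 1 = r + α by ring, show r + 1 + α = r + α + 1 by ring]
    field_simp

theorem abs_fracIntegral_le (hα : 0 < α) {h : ℝ → ℝ} {s C : ℝ} (hs : 0 ≤ s)
    (hC : ∀ τ ∈ Icc 0 s, |h τ| ≤ C) :
    |fracIntegral α h s| ≤ C * ((1 / Real.Gamma α) * (s ^ α / α)) := by
  have hG := Real.Gamma_pos_of_pos hα
  unfold fracIntegral
  rw [abs_mul, abs_of_pos (one_div_pos.2 hG), mul_left_comm]
  gcongr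
  have h1 := intervalIntegral.norm_integral_le_of_norm_le (μ := volume) hs
    (f := fun τ => (s - τ) ^ (α - 1) * h τ) (g := fun τ => (s - τ) ^ (α - 1) * C)
    (ae_of_all _ fun τ hτ => ?_)
    ((intervalIntegrable_sub_rpow (by linarith) 0 s s).mul_const C)
  · rw [intervalIntegral.integral_mul_const, integral_sub_rpow (by linarith)] at h1
    simpa [mul_comm] using h1
  · have h0 : 0 ≤ (s - τ) ^ (α - 1) := Real.rpow_nonneg (sub_nonneg.2 hτ.2) _
    rw [Real.norm_eq_abs, abs_mul, abs_of_nonneg h0]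
    exact mul_le_mul_of_nonneg_left (hC τ ⟨hτ.1.le, hτ.2⟩) h0

/-- The fractional integral of a polynomial is `s ^ α` times a polynomial, and Abel's inversion
formula holds for it. -/
theorem exists_fracIntegral_polynomial (hα : 0 < α) (hα1 : α < 1) (p : Polynomial ℝ) :
    ∃ q : Polynomial ℝ, ∀ s, 0 ≤ s → fracIntegral α (fun τ => p.eval τ) s = s ^ α * q.eval s ∧
      ∫ τ in (0:ℝ)..s, (s - τ) ^ (-α) * (τ ^ α * q.eval τ) =
        Real.Gamma (1 - α) * ∫ τ in (0:ℝ)..s, p.eval τ := by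
  have hcont : ∀ (r : Polynomial ℝ) (S : Set ℝ), ContinuousOn (fun τ : ℝ => τ ^ α * r.eval τ) S :=
    fun r S => ((Real.continuous_rpow_const hα.le).mul r.continuous).continuousOn
  induction p using Polynomial.induction_on' with
  | add p₁ p₂ h₁ h₂ =>
    obtain ⟨q₁, h₁⟩ := h₁
    obtain ⟨q₂, h₂⟩ := h₂
    refine ⟨q₁ + q₂, fun s hs => ?_⟩
    obtain ⟨a₁, b₁⟩ := h₁ s hs
    obtain ⟨a₂, b₂⟩ := h₂ s hs
    simp only [Polynomial.eval_add]
    constructor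
    · rw [fracIntegral_add hα hs p₁.continuous.continuousOn p₂.continuous.continuousOn, a₁, a₂]
      ring
    · simp only [mul_add]
      rw [intervalIntegral.integral_add
        (intervalIntegrable_sub_rpow_mul (by linarith) s hs (hcont _ _))
        (intervalIntegrable_sub_rpow_mul (by linarith) s hs (hcont _ _)), b₁, b₂,
        intervalIntegral.integral_add (p₁.continuous.intervalIntegrable _ _)
        (p₂.continuous.intervalIntegrable _ _)]
      ring
  | monomial n c =>
    set G := Real.Gamma ((n : ℝ) + 1) / Real.Gamma (n + α + 1) with hG
    refine ⟨Polynomial.monomial n (c * G), fun s hs => ?_⟩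
    simp only [Polynomial.eval_monomial]
    constructor
    · rw [fracIntegral_const_mul]
      have h := fracIntegral_rpow hα (r := n) (Nat.cast_nonneg n) hs
      simp only [Real.rpow_natCast] at h
      rw [h, Real.rpow_add_of_nonneg hs (Nat.cast_nonneg n) hα.le, Real.rpow_natCast]
      ring
    · rcases hs.eq_or_lt with rfl | hs
      · simp
      have h := integral_rpow_mul_sub_rpow (p := n + α + 1) (q := 1 - α)
        (by positivity) (by linarith) hs
      have e : ∀ τ ∈ uIcc 0 s, (s - τ) ^ (-α) * (τ ^ α * (c * G * τ ^ n)) =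
          (c * G) * ((s - τ) ^ (1 - α - 1) * τ ^ ((n : ℝ) + α + 1 - 1)) := by
        intro τ hτ
        rw [Set.uIcc_of_le hs.le] at hτ
        rw [show 1 - α - 1 = -α by ring, add_sub_cancel_right,
          Real.rpow_add_of_nonneg hτ.1 (Nat.cast_nonneg n) hα.le, Real.rpow_natCast]
        ring
      rw [intervalIntegral.integral_congr e, intervalIntegral.integral_const_mul, h,
        intervalIntegral.integral_const_mul, integral_pow, hG,
        show (n : ℝ) + α + 1 + (1 - α) - 1 = ((n + 1 : ℕ) : ℝ) by push_cast; ring,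
        show (n : ℝ) + α + 1 + (1 - α) = ((n : ℝ) + 1) + 1 by ring, Real.rpow_natCast,
        Real.Gamma_add_one (by positivity : (n : ℝ) + 1 ≠ 0)]
      have h1 := (Real.Gamma_pos_of_pos (by positivity : (0 : ℝ) < n + 1)).ne'
      have h2 := (Real.Gamma_pos_of_pos (by positivity : (0 : ℝ) < n + α + 1)).ne'
      field_simp
      ring

/-- If `g + I^α p`, with `p` a polynomial, attains its minimum over `[0, s₀]` at `s₀ > 0`,
then `p s₀ ≤ 0`. -/
theorem polynomial_eval_nonpos_of_isMin (hα : 0 < α) (hα1 : α < 1) (p : Polynomial ℝ) {g s₀ : ℝ}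
    (hs₀ : 0 < s₀) (hmin : ∀ s ∈ Icc 0 s₀, g + fracIntegral α (fun τ => p.eval τ) s₀ ≤
      g + fracIntegral α (fun τ => p.eval τ) s) : p.eval s₀ ≤ 0 := by
  obtain ⟨q, hq⟩ := exists_fracIntegral_polynomial hα hα1 p
  set m := g + fracIntegral α (fun τ => p.eval τ) s₀ with hm
  set w : ℝ → ℝ := fun τ => (g - m) + τ ^ α * q.eval τ with hw
  have hw_eq : ∀ s, 0 ≤ s → w s = g + fracIntegral α (fun τ => p.eval τ) s - m := by
    intro s hs
    rw [(hq s hs).1, hw]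
    ring
  have hw_nonneg : ∀ s ∈ Icc 0 s₀, 0 ≤ w s := by
    intro s hs
    rw [hw_eq s hs.1]
    linarith [hmin s hs]
  have hw_zero : w s₀ = 0 := by rw [hw_eq s₀ hs₀.le, hm]; ring
  have hw_cont : Continuous w :=
    continuous_const.add ((Real.continuous_rpow_const hα.le).mul q.continuous)
  have hgm : 0 ≤ g - m := by
    have := hmin 0 ⟨le_rfl, hs₀.le⟩
    rw [fracIntegral_zero_right] at this
    linarith
  have hw_diff : DifferentiableAt ℝ w s₀ :=
    ((Real.differentiableAt_rpow_const_of_ne α hs₀.ne').mul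
      q.differentiable.differentiableAt).const_add _
  obtain ⟨C, hC⟩ := hw_diff.isBigO_sub.bound
  obtain ⟨δ, hδ, hCδ⟩ := Metric.eventually_nhds_iff.1 hC
  set R : ℝ → ℝ := fun s => (g - m) * (s ^ (1 - α) / (1 - α)) +
    Real.Gamma (1 - α) * ∫ τ in (0:ℝ)..s, p.eval τ with hR
  have hint : ∀ s a b : ℝ, a ≤ b →
      IntervalIntegrable (fun τ => (s - τ) ^ (-α) * w τ) volume a b := fun s a b hab =>
    intervalIntegrable_sub_rpow_mul (by linarith) s hab hw_cont.continuousOn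
  have hR_eq : ∀ s, 0 ≤ s → R s = ∫ τ in (0:ℝ)..s, (s - τ) ^ (-α) * w τ := by
    intro s hs
    have hint' : IntervalIntegrable (fun τ => (s - τ) ^ (-α) * (τ ^ α * q.eval τ)) volume 0 s :=
      intervalIntegrable_sub_rpow_mul (by linarith) s hs
        ((Real.continuous_rpow_const hα.le).mul q.continuous).continuousOn
    simp only [hw, mul_add]
    rw [intervalIntegral.integral_add
      ((intervalIntegrable_sub_rpow (by linarith) 0 s s).mul_const _) hint',
      (hq s hs).2, intervalIntegral.integral_mul_const, integral_sub_rpow (by linarith), hR,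
      show -α + 1 = 1 - α by ring]
    ring
  have hR_deriv : HasDerivAt R
      ((g - m) * s₀ ^ (-α) + Real.Gamma (1 - α) * p.eval s₀) s₀ := by
    have h1 := ((Real.hasDerivAt_rpow_const (p := 1 - α) (Or.inl hs₀.ne')).div_const
      (1 - α)).const_mul (g - m)
    have h2 := (intervalIntegral.integral_hasDerivAt_right (p.continuous.intervalIntegrable 0 s₀)
      (p.continuous.stronglyMeasurableAtFilter _ _) p.continuous.continuousAt).const_mul
      (Real.Gamma (1 - α))
    convert! h1.add h2 using 2
    rw [show 1 - α - 1 = -α by ring, mul_div_cancel_left₀ _ (by linarith : 1 - α ≠ 0)]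
  have hR_slope : ∀ᶠ s in 𝓝[<] s₀, slope R s₀ s ≤ C * (s₀ - s) ^ (1 - α) := by
    have hnear : ∀ᶠ s in 𝓝[<] s₀, s ∈ Ioo (max 0 (s₀ - δ)) s₀ :=
      Ioo_mem_nhdsLT (max_lt hs₀ (by linarith))
    filter_upwards [hnear] with s hs
    have hs0 : 0 < s := (le_max_left _ _).trans_lt hs.1
    have hsδ : s₀ - δ < s := (le_max_right _ _).trans_lt hs.1
    have hss := hs.2
    have hCnn : 0 ≤ C := by
      have h := hCδ (y := s) (by rw [Real.dist_eq, abs_lt]; constructor <;> linarith)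
      have h' : 0 < ‖s - s₀‖ := norm_pos_iff.2 (by linarith)
      exact nonneg_of_mul_nonneg_left ((norm_nonneg _).trans h) h'
    have h1 : ∫ τ in (0:ℝ)..s, (s₀ - τ) ^ (-α) * w τ ≤ ∫ τ in (0:ℝ)..s, (s - τ) ^ (-α) * w τ := by
      refine intervalIntegral.integral_mono_on_of_le_Ioo hs0.le (hint _ _ _ hs0.le)
        (hint _ _ _ hs0.le) fun τ hτ => ?_
      refine mul_le_mul_of_nonneg_right ?_ (hw_nonneg τ ⟨hτ.1.le, (hτ.2.trans hss).le⟩)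
      exact Real.rpow_le_rpow_of_nonpos (sub_pos.2 hτ.2) (by linarith) (by linarith)
    have h2 : ∫ τ in s..s₀, (s₀ - τ) ^ (-α) * w τ ≤ ∫ τ in s..s₀, C * (s₀ - s) ^ (1 - α) := by
      refine intervalIntegral.integral_mono_on_of_le_Ioo hss.le (hint _ _ _ hss.le)
        intervalIntegrable_const fun τ hτ => ?_
      have hτ0 : 0 < s₀ - τ := sub_pos.2 hτ.2
      have h := hCδ (y := τ) (by rw [Real.dist_eq, abs_lt]; constructor <;> linarith [hτ.1])
      rw [hw_zero, sub_zero, Real.norm_eq_abs, Real.norm_eq_abs, abs_sub_comm,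
        abs_of_pos hτ0] at h
      calc (s₀ - τ) ^ (-α) * w τ ≤ (s₀ - τ) ^ (-α) * (C * (s₀ - τ)) :=
            mul_le_mul_of_nonneg_left ((le_abs_self _).trans h) (Real.rpow_nonneg hτ0.le _)
        _ = C * (s₀ - τ) ^ (1 - α) := by
            rw [show 1 - α = -α + 1 by ring, Real.rpow_add_one hτ0.ne']; ring
        _ ≤ C * (s₀ - s) ^ (1 - α) := by
            gcongr
            exact hτ.1.le
    have h3 := intervalIntegral.integral_add_adjacent_intervals (hint s₀ 0 s hs0.le)
      (hint s₀ s s₀ hss.le)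
    rw [← hR_eq s₀ hs₀.le] at h3
    rw [← hR_eq s hs0.le] at h1
    rw [intervalIntegral.integral_const, smul_eq_mul] at h2
    rw [slope_comm, slope_def_field, div_le_iff₀ (by linarith)]
    linarith
  have hlim : Tendsto (fun s => C * (s₀ - s) ^ (1 - α)) (𝓝[<] s₀) (𝓝 0) := by
    have h : Continuous fun s => C * (s₀ - s) ^ (1 - α) :=
      continuous_const.mul ((Real.continuous_rpow_const (by linarith)).comp
        (continuous_const.sub continuous_id))
    have h' := h.tendsto s₀
    rw [sub_self, Real.zero_rpow (by linarith), mul_zero] at h'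
    exact h'.mono_left nhdsWithin_le_nhds
  have hfinal := le_of_tendsto_of_tendsto
    ((hasDerivWithinAt_iff_tendsto_slope' (by simp)).1 (hR_deriv.hasDerivWithinAt (s := Iio s₀)))
    hlim hR_slope
  have hΓ : 0 < Real.Gamma (1 - α) := Real.Gamma_pos_of_pos (by linarith)
  have : 0 ≤ (g - m) * s₀ ^ (-α) := mul_nonneg hgm (Real.rpow_nonneg hs₀.le _)
  by_contra hp
  have := mul_pos hΓ (not_le.1 hp)
  linarith

/-- If `g + I^α h` is strictly larger on `[0, s₁)` than at `s₁ > 0`, then `h s₁ ≤ 0`. -/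
theorem nonpos_of_fracIntegral_lt (hα : 0 < α) (hα1 : α ≤ 1) {h : ℝ → ℝ} {g s₁ : ℝ}
    (hs₁ : 0 < s₁) (hh : ContinuousOn h (Icc 0 s₁))
    (hw : ContinuousOn (fracIntegral α h) (Icc 0 s₁))
    (hlt : ∀ s ∈ Ico 0 s₁, g + fracIntegral α h s₁ < g + fracIntegral α h s) : h s₁ ≤ 0 := by
  by_contra! hpos
  have hev : ∀ᶠ s in 𝓝[Icc 0 s₁] s₁, h s₁ / 2 < h s :=
    (hh s₁ ⟨hs₁.le, le_rfl⟩).eventually (lt_mem_nhds (by linarith))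
  obtain ⟨δ, hδ, hball⟩ := Metric.mem_nhdsWithin_iff.1 hev
  set s' := max 0 (s₁ - δ / 2) with hs'
  have hs'0 : 0 ≤ s' := le_max_left _ _
  have hs'1 : s' < s₁ := max_lt hs₁ (by linarith)
  have hnear : ∀ s ∈ Icc s' s₁, h s₁ / 2 < h s := by
    intro s hs
    have h1 : s₁ - δ / 2 ≤ s := (le_max_right _ _).trans hs.1
    exact hball ⟨by rw [Metric.mem_ball, Real.dist_eq, abs_lt]; constructor <;> linarith [hs.2],
      hs'0.trans hs.1, hs.2⟩
  rcases hα1.eq_or_lt with rfl | hα1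
  · have hint : ∀ a b, 0 ≤ a → a ≤ b → b ≤ s₁ → IntervalIntegrable h volume a b :=
      fun a b ha hab hb => ContinuousOn.intervalIntegrable (by
        rw [Set.uIcc_of_le hab]; exact hh.mono (Icc_subset_Icc ha hb))
    have h1 := hlt s' ⟨hs'0, hs'1⟩
    simp only [fracIntegral, sub_self, Real.rpow_zero, one_mul, Real.Gamma_one, div_one] at h1
    rw [← intervalIntegral.integral_add_adjacent_intervals (hint 0 s' le_rfl hs'0 hs'1.le)
      (hint s' s₁ hs'0 hs'1.le le_rfl)] at h1
    have h2 : 0 ≤ ∫ x in s'..s₁, h x :=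
      intervalIntegral.integral_nonneg hs'1.le fun u hu => by linarith [hnear u hu]
    linarith
  · obtain ⟨z, hz, hzmin⟩ := isCompact_Icc.exists_isMinOn (nonempty_Icc.2 hs'0)
      (hw.mono (Icc_subset_Icc_right hs'1.le))
    set gap := fracIntegral α h z - fracIntegral α h s₁ with hgap
    have hgap0 : 0 < gap := by linarith [hlt z ⟨hz.1, hz.2.trans_lt hs'1⟩]
    set B := (1 / Real.Gamma α) * (s₁ ^ α / α) with hB
    have hΓ := Real.Gamma_pos_of_pos hα
    have hB0 : 0 < B := by positivity
    obtain ⟨p, hp⟩ := exists_polynomial_near_of_continuousOn 0 s₁ h hh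
      (min (h s₁ / 2) (gap / (3 * B))) (lt_min (by linarith) (by positivity))
    have happrox : ∀ s ∈ Icc 0 s₁,
        |fracIntegral α (fun τ => p.eval τ) s - fracIntegral α h s| ≤ gap / 3 := by
      intro s hs
      rw [← fracIntegral_sub hα hs.1 p.continuous.continuousOn
        (hh.mono (Icc_subset_Icc_right hs.2))]
      refine (abs_fracIntegral_le hα hs.1 (C := gap / (3 * B)) fun τ hτ => ?_).trans ?_
      · exact ((hp τ ⟨hτ.1, hτ.2.trans hs.2⟩).trans_le (min_le_right _ _)).le
      · calc gap / (3 * B) * (1 / Real.Gamma α * (s ^ α / α)) ≤ gap / (3 * B) * B := by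
              rw [hB]
              gcongr
              · exact hs.1
              · exact hs.2
          _ = gap / 3 := by field_simp
    obtain ⟨q, hq⟩ := exists_fracIntegral_polynomial hα hα1 p
    have hpc : ContinuousOn (fracIntegral α (fun τ => p.eval τ)) (Icc 0 s₁) :=
      (((Real.continuous_rpow_const hα.le).mul q.continuous).continuousOn).congr
        fun s hs => (hq s hs.1).1
    obtain ⟨s₀, hs₀, hs₀min⟩ := isCompact_Icc.exists_isMinOn (nonempty_Icc.2 hs₁.le) hpc
    have hs₀' : s' < s₀ := by
      by_contra! hle
      have h1 : fracIntegral α h z ≤ fracIntegral α h s₀ := hzmin ⟨hs₀.1, hle⟩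
      have h2 : fracIntegral α (fun τ => p.eval τ) s₀ ≤ fracIntegral α (fun τ => p.eval τ) s₁ :=
        hs₀min ⟨hs₁.le, le_rfl⟩
      have h3 := abs_le.1 (happrox s₀ hs₀)
      have h4 := abs_le.1 (happrox s₁ ⟨hs₁.le, le_rfl⟩)
      linarith [h3.1, h4.2]
    have h1 := polynomial_eval_nonpos_of_isMin hα hα1 p (g := 0) (hs'0.trans_lt hs₀')
      fun s hs => by
        have : fracIntegral α (fun τ => p.eval τ) s₀ ≤ fracIntegral α (fun τ => p.eval τ) s :=
          hs₀min ⟨hs.1, hs.2.trans hs₀.2⟩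
        linarith
    have h2 := hnear s₀ ⟨hs₀'.le, hs₀.2⟩
    have h3 := abs_lt.1 ((hp s₀ hs₀).trans_le (min_le_left _ _))
    linarith [h3.1]

theorem Gamma_div_Gamma_add_le (hα : 0 < α) (hα1 : α ≤ 1) {y : ℝ} (hy : 1 ≤ y) :
    Real.Gamma y / Real.Gamma (y + α) ≤ 2 * y ^ (-α) := by
  have hy0 : 0 < y := by linarith
  have hG := Real.Gamma_pos_of_pos (by linarith : 0 < y + α)
  have key : y * Real.Gamma y ≤ Real.Gamma (y + α) * (y + α) ^ (1 - α) := by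
    rw [← Real.Gamma_add_one hy0.ne']
    rcases hα1.eq_or_lt with rfl | hα1
    · simp
    have h := Real.Gamma_mul_add_mul_le_rpow_Gamma_mul_rpow_Gamma (s := y + α) (t := y + α + 1)
      (by linarith) (by linarith) hα (sub_pos.2 hα1) (by ring)
    rw [show α * (y + α) + (1 - α) * (y + α + 1) = y + 1 by ring,
      Real.Gamma_add_one (by linarith : y + α ≠ 0),
      Real.mul_rpow (by linarith) hG.le, mul_left_comm, ← Real.rpow_add hG,
      add_sub_cancel, Real.rpow_one] at h
    linarith
  have h2 : (y + α) ^ (1 - α) ≤ 2 * (y * y ^ (-α)) := by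
    calc (y + α) ^ (1 - α) ≤ (2 * y) ^ (1 - α) := by
          gcongr
          linarith
      _ = 2 ^ (1 - α) * y ^ (1 - α) := Real.mul_rpow (by norm_num) hy0.le
      _ ≤ 2 ^ (1 : ℝ) * y ^ (1 - α) := by
          gcongr
          · norm_num
          · linarith
      _ = 2 * (y * y ^ (-α)) := by
          rw [Real.rpow_one, sub_eq_add_neg, Real.rpow_add hy0, Real.rpow_one]
  rw [div_le_iff₀ hG]
  refine le_of_mul_le_mul_left (key.trans ?_) hy0
  calc Real.Gamma (y + α) * (y + α) ^ (1 - α)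
      ≤ Real.Gamma (y + α) * (2 * (y * y ^ (-α))) := by gcongr
    _ = y * (2 * y ^ (-α) * Real.Gamma (y + α)) := by ring

theorem summable_mittagLeffler (hα : 0 < α) (hα1 : α ≤ 1) (x : ℝ) :
    Summable fun k : ℕ => x ^ k / Real.Gamma (α * (k : ℝ) + 1) := by
  have hlim : Tendsto (fun k : ℕ => |x| * (2 * (α * (k : ℝ) + 1) ^ (-α))) atTop (𝓝 0) := by
    have h1 : Tendsto (fun k : ℕ => α * (k : ℝ) + 1) atTop atTop :=
      tendsto_atTop_add_const_right _ _ (tendsto_natCast_atTop_atTop.const_mul_atTop hα)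
    simpa using ((((tendsto_rpow_neg_atTop hα).comp h1).const_mul 2).const_mul |x|)
  refine summable_of_ratio_norm_eventually_le (r := 1 / 2) (by norm_num) ?_
  filter_upwards [hlim.eventually_le_const (show (0 : ℝ) < 1 / 2 by norm_num)] with k hk
  have hy : 1 ≤ α * (k : ℝ) + 1 := by
    have : 0 ≤ α * (k : ℝ) := by positivity
    linarith
  have hG := Real.Gamma_pos_of_pos (by linarith : 0 < α * (k : ℝ) + 1)
  have hG' := Real.Gamma_pos_of_pos (by linarith : 0 < α * (k : ℝ) + 1 + α)
  have hΓ := Gamma_div_Gamma_add_le hα hα1 hy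
  push_cast
  rw [show α * ((k : ℝ) + 1) + 1 = α * k + 1 + α by ring, norm_div, norm_div, norm_pow, norm_pow,
    Real.norm_of_nonneg hG.le, Real.norm_of_nonneg hG'.le, Real.norm_eq_abs]
  calc |x| ^ (k + 1) / Real.Gamma (α * k + 1 + α)
      = |x| * (Real.Gamma (α * k + 1) / Real.Gamma (α * k + 1 + α)) *
        (|x| ^ k / Real.Gamma (α * k + 1)) := by field_simp; ring
    _ ≤ 1 / 2 * (|x| ^ k / Real.Gamma (α * k + 1)) := by
        refine mul_le_mul_of_nonneg_right (le_trans ?_ hk) (by positivity)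
        gcongr

theorem abs_mittagLeffler_term_le (hα : 0 < α) (c : ℝ) {τ s : ℝ} (hτ : τ ∈ Icc 0 s) (k : ℕ) :
    |(c * τ ^ α) ^ k / Real.Gamma (α * (k : ℝ) + 1)| ≤
      (|c| * s ^ α) ^ k / Real.Gamma (α * (k : ℝ) + 1) := by
  have hG := Real.Gamma_pos_of_pos (by positivity : 0 < α * (k : ℝ) + 1)
  rw [abs_div, abs_pow, abs_mul, abs_of_pos hG, abs_of_nonneg (Real.rpow_nonneg hτ.1 _)]
  have h0 := hτ.1
  have h1 := hτ.2
  gcongr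

theorem continuousOn_mittagLeffler (hα : 0 < α) (hα1 : α ≤ 1) (c s : ℝ) :
    ContinuousOn (fun τ => mittagLeffler α (c * τ ^ α)) (Icc 0 s) :=
  continuousOn_tsum
    (fun k => (((continuous_const.mul (Real.continuous_rpow_const hα.le)).pow k).div_const
      _).continuousOn)
    (summable_mittagLeffler hα hα1 (|c| * s ^ α))
    fun k _ hτ => abs_mittagLeffler_term_le hα c hτ k

theorem mittagLeffler_eq_one_add_tsum (hα : 0 < α) (hα1 : α ≤ 1) (x : ℝ) :
    mittagLeffler α x = 1 + ∑' k : ℕ, x ^ (k + 1) / Real.Gamma (α * (k + 1 : ℕ) + 1) := by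
  rw [mittagLeffler, (summable_mittagLeffler hα hα1 x).tsum_eq_zero_add]
  simp

theorem one_le_mittagLeffler (hα : 0 < α) (hα1 : α ≤ 1) {x : ℝ} (hx : 0 ≤ x) :
    1 ≤ mittagLeffler α x := by
  rw [mittagLeffler_eq_one_add_tsum hα hα1, le_add_iff_nonneg_right]
  exact tsum_nonneg fun k =>
    div_nonneg (pow_nonneg hx _) (Real.Gamma_pos_of_pos (by positivity)).le

/-- `s ↦ E_α(c s ^ α)` solves the linear Volterra equation `v = 1 + c I^α v`. -/
theorem mittagLeffler_eq_one_add_fracIntegral (hα : 0 < α) (hα1 : α ≤ 1) (c : ℝ) {s : ℝ}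
    (hs : 0 ≤ s) : mittagLeffler α (c * s ^ α) =
      1 + c * fracIntegral α (fun τ => mittagLeffler α (c * τ ^ α)) s := by
  have hsum := intervalIntegral.hasSum_integral_of_dominated_convergence (μ := volume)
    (a := 0) (b := s)
    (F := fun (k : ℕ) τ => (s - τ) ^ (α - 1) * ((c * τ ^ α) ^ k / Real.Gamma (α * (k : ℝ) + 1)))
    (f := fun τ => (s - τ) ^ (α - 1) * mittagLeffler α (c * τ ^ α))
    (fun (k : ℕ) τ => (s - τ) ^ (α - 1) * ((|c| * s ^ α) ^ k / Real.Gamma (α * (k : ℝ) + 1)))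
    (fun k => by
      have h := intervalIntegrable_sub_rpow_mul (β := α - 1) (by linarith) s hs
        (h := fun τ => (c * τ ^ α) ^ k / Real.Gamma (α * (k : ℝ) + 1))
        (((continuous_const.mul (Real.continuous_rpow_const hα.le)).pow k).div_const
          _).continuousOn
      exact h.aestronglyMeasurable_restrict_uIoc)
    (fun k => ae_of_all _ fun τ hτ => by
      rw [Set.uIoc_of_le hs] at hτ
      have h0 : 0 ≤ (s - τ) ^ (α - 1) := Real.rpow_nonneg (sub_nonneg.2 hτ.2) _
      rw [norm_mul, Real.norm_of_nonneg h0]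
      exact mul_le_mul_of_nonneg_left (abs_mittagLeffler_term_le hα c ⟨hτ.1.le, hτ.2⟩ k) h0)
    (ae_of_all _ fun τ _ => (summable_mittagLeffler hα hα1 _).mul_left _)
    (by
      simp only [tsum_mul_left]
      exact (intervalIntegrable_sub_rpow (by linarith) 0 s s).mul_const _)
    (ae_of_all _ fun τ _ => (summable_mittagLeffler hα hα1 _).hasSum.mul_left _)
  rw [mittagLeffler_eq_one_add_tsum hα hα1, fracIntegral, ← hsum.tsum_eq, ← tsum_mul_left,
    ← tsum_mul_left]
  congr 1
  refine tsum_congr fun k => ?_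
  have hterm : fracIntegral α (fun τ => (c * τ ^ α) ^ k / Real.Gamma (α * (k : ℝ) + 1)) s =
      c ^ k / Real.Gamma (α * (k : ℝ) + 1) * fracIntegral α (fun τ => τ ^ (α * (k : ℝ))) s := by
    rw [← fracIntegral_const_mul]
    refine fracIntegral_congr hs fun τ hτ => ?_
    rw [mul_pow, ← Real.rpow_mul_natCast hτ.1]
    ring
  rw [fracIntegral_rpow hα (by positivity) hs, fracIntegral] at hterm
  rw [hterm, mul_pow, ← Real.rpow_mul_natCast hs]
  have hG := (Real.Gamma_pos_of_pos (by positivity : 0 < α * (k : ℝ) + 1)).ne'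
  push_cast
  rw [show α * ((k : ℝ) + 1) = α * k + α by ring]
  field_simp
  ring

/-- Minimum principle for fractional Volterra equations. -/
theorem nonneg_of_eq_add_fracIntegral (hα : 0 < α) (hα1 : α ≤ 1) {w h : ℝ → ℝ} {g c t : ℝ}
    (hg : 0 ≤ g) (hw : ContinuousOn w (Icc 0 t)) (hh : ContinuousOn h (Icc 0 t))
    (hwh : ∀ s ∈ Icc 0 t, w s = g + fracIntegral α h s)
    (hneg : ∀ s ∈ Icc 0 t, w s < 0 → c * w s ≤ h s) : ∀ s ∈ Icc 0 t, 0 ≤ w s := by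
  intro s hs
  by_contra! hws
  set K := |c| + 1 with hK
  have hK0 : 0 ≤ K := by positivity
  set E : ℝ → ℝ := fun τ => mittagLeffler α (K * τ ^ α)
  have hEc : ContinuousOn E (Icc 0 t) := continuousOn_mittagLeffler hα hα1 K t
  have hE1 : ∀ r, 0 ≤ r → 1 ≤ E r := fun r hr =>
    one_le_mittagLeffler hα hα1 (mul_nonneg hK0 (Real.rpow_nonneg hr _))
  have hEs : 0 < E s := zero_lt_one.trans_le (hE1 s hs.1)
  set ε := -w s / E s with hε
  have hε0 : 0 < ε := div_pos (by linarith) hEs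
  set v : ℝ → ℝ := fun r => w r + ε * E r with hv
  have hvc : ContinuousOn v (Icc 0 t) := hw.add (continuousOn_const.mul hEc)
  have hvs : v s = 0 := by simp only [hv, hε]; field_simp; ring
  have hv0 : 0 < v 0 := by
    have h1 := hwh 0 ⟨le_rfl, hs.1.trans hs.2⟩
    rw [fracIntegral_zero_right] at h1
    have h2 := mul_pos hε0 (zero_lt_one.trans_le (hE1 0 le_rfl))
    simp only [hv]
    linarith
  have hvcs : ContinuousOn v (Icc 0 s) := hvc.mono (Icc_subset_Icc_right hs.2)
  have hclosed : IsClosed (Icc 0 s ∩ v ⁻¹' {0}) :=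
    hvcs.preimage_isClosed_of_isClosed isClosed_Icc isClosed_singleton
  obtain ⟨s₁, ⟨hs₁, hvs₁⟩, hleast⟩ :=
    (isCompact_Icc.of_isClosed_subset hclosed inter_subset_left).exists_isLeast
      ⟨s, ⟨hs.1, le_rfl⟩, hvs⟩
  have hvs₁ : v s₁ = 0 := hvs₁
  have hs₁0 : 0 < s₁ := hs₁.1.lt_of_ne fun h => by rw [← h] at hvs₁; linarith
  have hs₁t : s₁ ≤ t := hs₁.2.trans hs.2
  have hvpos : ∀ r ∈ Ico 0 s₁, 0 < v r := by
    intro r hr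
    by_contra! hle
    obtain ⟨r', hr', hvr'⟩ := intermediate_value_Icc' hr.1
      (hvc.mono (Icc_subset_Icc_right (hr.2.le.trans hs₁t))) ⟨hle, hv0.le⟩
    have := hleast ⟨⟨hr'.1, hr'.2.trans (hr.2.le.trans hs₁.2)⟩, hvr'⟩
    linarith [hr'.2, hr.2]
  set h' : ℝ → ℝ := fun r => h r + ε * K * E r with hh'
  have hh'c : ContinuousOn h' (Icc 0 t) := hh.add (continuousOn_const.mul hEc)
  have hveq : ∀ r ∈ Icc 0 t, v r = (g + ε) + fracIntegral α h' r := by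
    intro r hr
    have hsub := Icc_subset_Icc_right (b := (0 : ℝ)) hr.2
    have hEr : ContinuousOn (fun r => ε * K * E r) (Icc 0 r) :=
      continuousOn_const.mul (hEc.mono hsub)
    rw [hh', fracIntegral_add hα hr.1 (hh.mono hsub) hEr, fracIntegral_const_mul]
    simp only [hv]
    rw [hwh r hr, show E r = 1 + K * fracIntegral α E r from
      mittagLeffler_eq_one_add_fracIntegral hα hα1 K hr.1]
    ring
  have hsub := Icc_subset_Icc_right (b := (0 : ℝ)) hs₁t
  have hs₁mem : s₁ ∈ Icc 0 t := ⟨hs₁0.le, hs₁t⟩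
  have hIc : ContinuousOn (fracIntegral α h') (Icc 0 t) :=
    (hvc.sub (continuousOn_const (c := g + ε))).congr fun r hr => by
      simp only [Pi.sub_apply, hveq r hr, add_sub_cancel_left]
  have hle := nonpos_of_fracIntegral_lt hα hα1 (g := g + ε) hs₁0 (hh'c.mono hsub)
    (hIc.mono hsub) fun r hr => by
      rw [← hveq s₁ hs₁mem, ← hveq r ⟨hr.1, hr.2.le.trans hs₁t⟩, hvs₁]
      exact hvpos r hr
  have hpos : 0 < ε * E s₁ := mul_pos hε0 (zero_lt_one.trans_le (hE1 s₁ hs₁0.le))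
  have hw₁ : w s₁ = -(ε * E s₁) := by simp only [hv] at hvs₁; linarith
  have h1 := hneg s₁ hs₁mem (by linarith)
  rw [hw₁] at h1
  have h2 : c * (ε * E s₁) ≤ |c| * (ε * E s₁) := by
    gcongr
    exact le_abs_self c
  simp only [hh', hK] at hle
  nlinarith

end FracIntegral

/-- General separation bounds: for solutions `x₁, x₂` with `x₁₀ < x₂₀`,
`(x₂(0)−x₁(0))·E_α(ã_*(t)·t^α) ≤ x₂(t)−x₁(t) ≤ (x₂(0)−x₁(0))·E_α(ã^*(t)·t^α)`,
where `ã_*(t)` and `ã^*(t)` are the infimum and supremum of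
`(f(s, x+x₁(s)) − f(s, x₁(s)))/x` over `s ∈ [0,t]`, `x ≠ 0`. -/
theorem caputo_separation_general (α T : ℝ) (hα : 0 < α) (hα1 : α ≤ 1) (hT : 0 < T)
    (f : ℝ → ℝ → ℝ)
    (hf : ContinuousOn (fun p : ℝ × ℝ => f p.1 p.2) (Set.Icc 0 T ×ˢ Set.univ))
    (L : ℝ → ℝ) (hLc : ContinuousOn L (Set.Icc 0 T))
    (hLnn : ∀ t ∈ Set.Icc 0 T, 0 ≤ L t)
    (hLip : ∀ t ∈ Set.Icc 0 T, ∀ x y : ℝ, |f t x - f t y| ≤ L t * |x - y|)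
    (x₁₀ x₂₀ : ℝ) (hlt : x₁₀ < x₂₀) (x₁ x₂ : ℝ → ℝ)
    (hx₁ : IsCaputoSolution α T f x₁₀ x₁) (hx₂ : IsCaputoSolution α T f x₂₀ x₂) :
    ∀ t ∈ Set.Icc 0 T,
      (x₂ 0 - x₁ 0) * mittagLeffler α
          (sInf {y | ∃ s ∈ Set.Icc 0 t, ∃ x : ℝ, x ≠ 0 ∧
              y = (f s (x + x₁ s) - f s (x₁ s)) / x} * t ^ α)
          ≤ x₂ t - x₁ t ∧
        x₂ t - x₁ t ≤ (x₂ 0 - x₁ 0) * mittagLeffler α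
          (sSup {y | ∃ s ∈ Set.Icc 0 t, ∃ x : ℝ, x ≠ 0 ∧
              y = (f s (x + x₁ s) - f s (x₁ s)) / x} * t ^ α) := by
  intro t ht
  obtain ⟨hx₁c, hx₁⟩ := hx₁
  obtain ⟨hx₂c, hx₂⟩ := hx₂
  set S := {y | ∃ s ∈ Set.Icc 0 t, ∃ x : ℝ, x ≠ 0 ∧ y = (f s (x + x₁ s) - f s (x₁ s)) / x}
  obtain ⟨M, hM⟩ := isCompact_Icc.bddAbove_image hLc
  have hLM : ∀ s ∈ Set.Icc 0 T, L s ≤ M := fun s hs => hM (mem_image_of_mem L hs)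
  have hsub : Set.Icc 0 t ⊆ Set.Icc 0 T := Icc_subset_Icc_right ht.2
  have hSM : ∀ y ∈ S, |y| ≤ M := by
    rintro y ⟨s, hs, x, hx, rfl⟩
    have h := hLip s (hsub hs) (x + x₁ s) (x₁ s)
    rw [add_sub_cancel_right] at h
    rw [abs_div, div_le_iff₀ (abs_pos.2 hx)]
    exact h.trans (mul_le_mul_of_nonneg_right (hLM s (hsub hs)) (abs_nonneg x))
  have hbelow : BddBelow S := ⟨-M, fun y hy => (abs_le.1 (hSM y hy)).1⟩
  have habove : BddAbove S := ⟨M, fun y hy => (abs_le.1 (hSM y hy)).2⟩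
  set lo := sInf S
  set hi := sSup S
  set u : ℝ → ℝ := fun s => x₂ s - x₁ s with hu
  set F : ℝ → ℝ := fun s => f s (x₂ s) - f s (x₁ s) with hF
  have hfc : ∀ x : ℝ → ℝ, ContinuousOn x (Set.Icc 0 T) →
      ContinuousOn (fun s => f s (x s)) (Set.Icc 0 T) := fun x hx =>
    hf.comp (continuousOn_id.prodMk hx) fun s hs => ⟨hs, mem_univ _⟩
  have huc : ContinuousOn u (Set.Icc 0 t) := (hx₂c.sub hx₁c).mono hsub
  have hFc : ContinuousOn F (Set.Icc 0 t) := ((hfc x₂ hx₂c).sub (hfc x₁ hx₁c)).mono hsub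
  have hueq : ∀ s ∈ Set.Icc 0 t, u s = (x₂₀ - x₁₀) + fracIntegral α F s := by
    intro s hs
    have hsub' : Set.Icc 0 s ⊆ Set.Icc 0 T := Icc_subset_Icc_right (hs.2.trans ht.2)
    rw [hF, fracIntegral_sub hα hs.1 ((hfc x₂ hx₂c).mono hsub') ((hfc x₁ hx₁c).mono hsub')]
    simp only [hu, fracIntegral]
    rw [hx₁ s (hsub hs), hx₂ s (hsub hs)]
    ring
  have hu0 : x₂ 0 - x₁ 0 = x₂₀ - x₁₀ := by
    have h := hueq 0 ⟨le_rfl, ht.1⟩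
    rwa [fracIntegral_zero_right, add_zero] at h
  have hquot : ∀ s ∈ Set.Icc 0 t, u s ≠ 0 → F s / u s ∈ S := fun s hs hne =>
    ⟨s, hs, u s, hne, by simp only [hu, hF, sub_add_cancel]⟩
  have hu_nonneg : ∀ s ∈ Set.Icc 0 t, 0 ≤ u s := by
    refine nonneg_of_eq_add_fracIntegral (c := M) hα hα1 (sub_nonneg.2 hlt.le) huc hFc hueq
      fun s hs hneg => ?_
    have h := (abs_le.1 (hSM _ (hquot s hs hneg.ne))).2
    rwa [div_le_iff_of_neg hneg] at h
  have hFlo : ∀ s ∈ Set.Icc 0 t, lo * u s ≤ F s ∧ F s ≤ hi * u s := by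
    intro s hs
    rcases (hu_nonneg s hs).eq_or_lt with h0 | hpos
    · have h12 : x₂ s = x₁ s := sub_eq_zero.1 h0.symm
      rw [← h0]
      simp only [hF, h12, sub_self, mul_zero, le_refl, and_self]
    · have hmem := hquot s hs hpos.ne'
      exact ⟨(le_div_iff₀ hpos).1 (csInf_le hbelow hmem),
        (div_le_iff₀ hpos).1 (le_csSup habove hmem)⟩
  have hVc : ∀ c : ℝ, ContinuousOn
      (fun s => (x₂₀ - x₁₀) * mittagLeffler α (c * s ^ α)) (Set.Icc 0 t) := fun c =>
    continuousOn_const.mul (continuousOn_mittagLeffler hα hα1 c t)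
  have hVeq : ∀ c : ℝ, ∀ s ∈ Set.Icc 0 t, (x₂₀ - x₁₀) * mittagLeffler α (c * s ^ α) =
      (x₂₀ - x₁₀) +
        fracIntegral α (fun τ => c * ((x₂₀ - x₁₀) * mittagLeffler α (c * τ ^ α))) s := by
    intro c s hs
    rw [fracIntegral_const_mul, fracIntegral_const_mul,
      mittagLeffler_eq_one_add_fracIntegral hα hα1 c hs.1]
    ring
  have htt : t ∈ Set.Icc 0 t := ⟨ht.1, le_rfl⟩
  rw [hu0]
  constructor
  · have hcV := continuousOn_const (c := lo) |>.mul (hVc lo)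
    refine sub_nonneg.1 (nonneg_of_eq_add_fracIntegral (c := lo) hα hα1 le_rfl
      (huc.sub (hVc lo)) (hFc.sub hcV) (fun s hs => ?_) (fun s hs _ => ?_) t htt)
    · have hs' := Icc_subset_Icc_right (b := (0 : ℝ)) hs.2
      have h := fracIntegral_sub hα hs.1 (hFc.mono hs') (hcV.mono hs')
      have h1 := hueq s hs
      have h2 := hVeq lo s hs
      simp only [Pi.sub_def, Pi.mul_def] at h ⊢
      linarith
    · have h := (hFlo s hs).1
      simp only [Pi.sub_def, Pi.mul_def]
      linarith
  · have hcV := continuousOn_const (c := hi) |>.mul (hVc hi)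
    refine sub_nonneg.1 (nonneg_of_eq_add_fracIntegral (c := hi) hα hα1 le_rfl
      ((hVc hi).sub huc) (hcV.sub hFc) (fun s hs => ?_) (fun s hs _ => ?_) t htt)
    · have hs' := Icc_subset_Icc_right (b := (0 : ℝ)) hs.2
      have h := fracIntegral_sub hα hs.1 (hcV.mono hs') (hFc.mono hs')
      have h1 := hueq s hs
      have h2 := hVeq hi s hs
      simp only [Pi.sub_def, Pi.mul_def] at h ⊢
      linarith
    · have h := (hFlo s hs).2
      simp only [Pi.sub_def, Pi.mul_def]
      linarith
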